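/- Convergence on finite cavity-monotone networks: let G = (V,E) be a finite cavity-monotone network. Then for every activity t > 0 the cavity equation x = tΓ_G(x) admits a unique solution x(t) in [0,∞)^{Ē}, and this fixed point is globally attractive: for every initial configuration x⁰ ∈ [0,∞)^{Ē}, the iterates (tΓ_G)^k(x⁰) converge to x(t) as k → ∞. -/

import Mathlib

open Finset Filter
open scoped Classical ENNReal

section LocalDefs

variable {V : Type*} [DecidableEq V]

/-- Generating polynomial `Z(w) = Σ_{S ⊆ A} ν(S) ∏_{k∈S} w_k` of a measure `ν`
on the subsets of the ground set `A`. -/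
noncomputable def lZ (A : Finset V) (ν : Finset V → ℝ) (w : V → ℝ) : ℝ :=
  ∑ S ∈ A.powerset, ν S * ∏ k ∈ S, w k

/-- Gibbs--Boltzmann probability of the event `p` under external field `w`. -/
noncomputable def lProb (A : Finset V) (ν : Finset V → ℝ) (w : V → ℝ)
    (p : Finset V → Prop) : ℝ :=
  (∑ S ∈ A.powerset.filter p, ν S * ∏ k ∈ S, w k) / lZ A ν w

/-- The energy `U_ν(w)`, i.e. the expected cardinality of the random subset. -/
noncomputable def lEnergy (A : Finset V) (ν : Finset V → ℝ) (w : V → ℝ) : ℝ :=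
  (∑ S ∈ A.powerset, (S.card : ℝ) * ν S * ∏ k ∈ S, w k) / lZ A ν w

/-- `E^w_ν[|𝓕|·1_{e∈𝓕}]`. -/
noncomputable def lEnergyIn (A : Finset V) (ν : Finset V → ℝ) (e : V) (w : V → ℝ) : ℝ :=
  (∑ S ∈ A.powerset.filter (fun S => e ∈ S), (S.card : ℝ) * ν S * ∏ k ∈ S, w k) / lZ A ν w

/-- The cavity ratio `Γ^e_ν(w') = Z^{/e}(w') / Z^{∖e}(w')`; it only depends on the
coordinates of `w` different from `e`. -/
noncomputable def lGamma (A : Finset V) (ν : Finset V → ℝ) (e : V) (w : V → ℝ) : ℝ :=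
  (∑ S ∈ (A.erase e).powerset, ν (insert e S) * ∏ k ∈ S, w k) /
  (∑ S ∈ (A.erase e).powerset, ν S * ∏ k ∈ S, w k)

/-- Rayleigh property: pairwise negative correlation under every positive external field. -/
def lRayleigh (A : Finset V) (ν : Finset V → ℝ) : Prop :=
  ∀ w : V → ℝ, (∀ k ∈ A, 0 < w k) → ∀ e ∈ A, ∀ f ∈ A, e ≠ f →
    lProb A ν w (fun S => e ∈ S ∧ f ∈ S) ≤
      lProb A ν w (fun S => e ∈ S) * lProb A ν w (fun S => f ∈ S)

/-- Size-increasing property: every ground element positively influences the total size. -/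
def lSizeInc (A : Finset V) (ν : Finset V → ℝ) : Prop :=
  ∀ w : V → ℝ, (∀ k ∈ A, 0 < w k) → ∀ e ∈ A,
    lEnergy A ν w * lProb A ν w (fun S => e ∈ S) < lEnergyIn A ν e w

/-- Cavity-monotone: nonnegative, `ν(∅) > 0`, Rayleigh and size-increasing. -/
def lCavityMonotone (A : Finset V) (ν : Finset V → ℝ) : Prop :=
  (∀ S ∈ A.powerset, 0 ≤ ν S) ∧ 0 < ν ∅ ∧ lRayleigh A ν ∧ lSizeInc A ν

end LocalDefs

section NetworkDefs

variable {V : Type*} [DecidableEq V]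

/-- The cavity operator: `(Γ_G x)_{i→j}` is the cavity ratio of the local measure `μ i`
at the edge `ij`, with external field `(x_{k→i} : k ∈ ∂i ∖ {j})`.  Local measures are
encoded as functions of the set of neighbours selected. -/
noncomputable def cavOp (G : SimpleGraph V) [G.LocallyFinite]
    (μ : V → Finset V → ℝ) (x : V → V → ℝ) (i j : V) : ℝ :=
  (∑ S ∈ ((G.neighborFinset i).erase j).powerset, μ i (insert j S) * ∏ k ∈ S, x k i) /
  (∑ S ∈ ((G.neighborFinset i).erase j).powerset, μ i S * ∏ k ∈ S, x k i)

/-- One step of the cavity iteration at activity `t` : `x ↦ t Γ_G(x)`. -/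
noncomputable def cavStep (G : SimpleGraph V) [G.LocallyFinite]
    (μ : V → Finset V → ℝ) (t : ℝ) (x : V → V → ℝ) : V → V → ℝ :=
  fun i j => t * cavOp G μ x i j

/-- The neighbours `k` of `i` such that the edge `ik` belongs to the spanning subgraph `F`;
this encodes `F ∩ E_i` as a set of neighbours. -/
noncomputable def nbrsIn (G : SimpleGraph V) [G.LocallyFinite]
    (F : Finset (Sym2 V)) (i : V) : Finset V :=
  (G.neighborFinset i).filter (fun k => s(i, k) ∈ F)

variable [Fintype V]

/-- Global measure `μ(F) = ∏_i μ_i(F ∩ E_i)` of a spanning subgraph `F`. -/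
noncomputable def gWeight (G : SimpleGraph V) [DecidableRel G.Adj]
    (μ : V → Finset V → ℝ) (F : Finset (Sym2 V)) : ℝ :=
  ∏ i : V, μ i (nbrsIn G F i)

/-- Partition function `Z(G;t) = Σ_{F ⊆ E} μ(F) t^{|F|}`. -/
noncomputable def ZG (G : SimpleGraph V) [DecidableRel G.Adj]
    (μ : V → Finset V → ℝ) (t : ℝ) : ℝ :=
  ∑ F ∈ G.edgeFinset.powerset, gWeight G μ F * t ^ F.card

/-- Gibbs--Boltzmann probability of the event `p` at activity `t`. -/
noncomputable def gProb (G : SimpleGraph V) [DecidableRel G.Adj]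
    (μ : V → Finset V → ℝ) (t : ℝ) (p : Finset (Sym2 V) → Prop) : ℝ :=
  (∑ F ∈ G.edgeFinset.powerset.filter p, gWeight G μ F * t ^ F.card) / ZG G μ t

/-- Energy `U(G;t)`, the expected size of the random spanning subgraph. -/
noncomputable def UG (G : SimpleGraph V) [DecidableRel G.Adj]
    (μ : V → Finset V → ℝ) (t : ℝ) : ℝ :=
  (∑ F ∈ G.edgeFinset.powerset, (F.card : ℝ) * gWeight G μ F * t ^ F.card) / ZG G μ t

/-- `M(G)`, the maximum size of a spanning subgraph with positive weight. -/
noncomputable def MG (G : SimpleGraph V) [DecidableRel G.Adj]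
    (μ : V → Finset V → ℝ) : ℕ :=
  (G.edgeFinset.powerset.filter (fun F => 0 < gWeight G μ F)).sup Finset.card

end NetworkDefs

section Helpers

set_option linter.unusedSectionVars false

variable {V : Type*} [DecidableEq V]

lemma lZ_congr_w (A : Finset V) (ν : Finset V → ℝ) {w w' : V → ℝ}
    (h : ∀ k ∈ A, w k = w' k) : lZ A ν w = lZ A ν w' := by
  unfold lZ
  refine Finset.sum_congr rfl fun S hS => ?_
  rw [Finset.mem_powerset] at hS
  congr 1
  exact Finset.prod_congr rfl fun k hk => h k (hS hk)

lemma lZ_congr_nu (A : Finset V) {ν ν' : Finset V → ℝ} (w : V → ℝ)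
    (h : ∀ S, S ⊆ A → ν S = ν' S) : lZ A ν w = lZ A ν' w := by
  unfold lZ
  refine Finset.sum_congr rfl fun S hS => ?_
  rw [Finset.mem_powerset] at hS
  rw [h S hS]

lemma lZ_zero (A : Finset V) (w : V → ℝ) : lZ A (fun _ => 0) w = 0 := by
  simp [lZ]

lemma lZ_split (A : Finset V) (ν : Finset V → ℝ) (w : V → ℝ) {e : V} (he : e ∈ A) :
    lZ A ν w = lZ (A.erase e) ν w + w e * lZ (A.erase e) (fun S => ν (insert e S)) w := by
  unfold lZ
  conv_lhs => rw [← Finset.insert_erase he]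
  rw [Finset.sum_powerset_insert (Finset.notMem_erase e A), Finset.mul_sum]
  congr 1
  refine Finset.sum_congr rfl fun S hS => ?_
  rw [Finset.mem_powerset] at hS
  have : e ∉ S := fun h => Finset.notMem_erase e A (hS h)
  rw [Finset.prod_insert this]
  ring

lemma lZ_filter (A : Finset V) (ν : Finset V → ℝ) (w : V → ℝ) (p : Finset V → Prop)
    {_ : DecidablePred p} :
    ∑ S ∈ A.powerset.filter p, ν S * ∏ k ∈ S, w k = lZ A (fun S => if p S then ν S else 0) w := by
  unfold lZ
  rw [Finset.sum_filter]
  refine Finset.sum_congr rfl fun S _ => ?_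
  by_cases hp : p S <;> simp [hp]

lemma lZ_filter_mem (A : Finset V) (ν : Finset V → ℝ) (w : V → ℝ) {e : V} (he : e ∈ A)
    {_ : DecidablePred (fun S : Finset V => e ∈ S)} :
    ∑ S ∈ A.powerset.filter (fun S => e ∈ S), ν S * ∏ k ∈ S, w k
      = w e * lZ (A.erase e) (fun S => ν (insert e S)) w := by
  rw [lZ_filter, lZ_split A _ w he]
  have h1 : lZ (A.erase e) (fun S => if e ∈ S then ν S else 0) w = 0 := by
    refine (lZ_congr_nu (ν' := fun _ => 0) _ _ fun S hS => ?_).trans (lZ_zero _ _)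
    have : e ∉ S := fun h => Finset.notMem_erase e A (hS h)
    simp [this]
  rw [h1, zero_add]
  congr 1
  exact lZ_congr_nu _ _ fun S hS => by simp

lemma lZ_filter_mem2 (A : Finset V) (ν : Finset V → ℝ) (w : V → ℝ) {e f : V} (he : e ∈ A)
    (hf : f ∈ A) (hef : e ≠ f) {_ : DecidablePred (fun S : Finset V => e ∈ S ∧ f ∈ S)} :
    ∑ S ∈ A.powerset.filter (fun S => e ∈ S ∧ f ∈ S), ν S * ∏ k ∈ S, w k
      = w e * (w f * lZ ((A.erase e).erase f) (fun S => ν (insert e (insert f S))) w) := by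
  have hf' : f ∈ A.erase e := Finset.mem_erase.2 ⟨hef.symm, hf⟩
  rw [lZ_filter, lZ_split A _ w he]
  have h1 : lZ (A.erase e) (fun S => if e ∈ S ∧ f ∈ S then ν S else 0) w = 0 := by
    refine (lZ_congr_nu (ν' := fun _ => 0) _ _ fun S hS => ?_).trans (lZ_zero _ _)
    have : e ∉ S := fun h => Finset.notMem_erase e A (hS h)
    simp [this]
  have h2 : lZ ((A.erase e).erase f) (fun S => if e ∈ insert e S ∧ f ∈ insert e S
      then ν (insert e S) else 0) w = 0 := by
    refine (lZ_congr_nu (ν' := fun _ => 0) _ _ fun S hS => ?_).trans (lZ_zero _ _)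
    have : f ∉ S := fun h => Finset.notMem_erase f _ (hS h)
    simp [this, hef.symm]
  rw [h1, zero_add, lZ_split (A.erase e) _ w hf', h2, zero_add]
  congr 2
  exact lZ_congr_nu _ _ fun S hS => by simp

lemma lZ_nonneg (A : Finset V) (ν : Finset V → ℝ) (w : V → ℝ)
    (hν : ∀ S, S ⊆ A → 0 ≤ ν S) (hw : ∀ k ∈ A, 0 ≤ w k) : 0 ≤ lZ A ν w := by
  unfold lZ
  refine Finset.sum_nonneg fun S hS => ?_
  rw [Finset.mem_powerset] at hS
  exact mul_nonneg (hν S hS) (Finset.prod_nonneg fun k hk => hw k (hS hk))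

lemma lZ_pos (A : Finset V) (ν : Finset V → ℝ) (w : V → ℝ)
    (hν : ∀ S, S ⊆ A → 0 ≤ ν S) (h0 : 0 < ν ∅) (hw : ∀ k ∈ A, 0 ≤ w k) : 0 < lZ A ν w := by
  unfold lZ
  refine Finset.sum_pos' (fun S hS => ?_) ⟨∅, Finset.empty_mem_powerset A, by simpa using h0⟩
  rw [Finset.mem_powerset] at hS
  exact mul_nonneg (hν S hS) (Finset.prod_nonneg fun k hk => hw k (hS hk))

lemma lZ_continuous (A : Finset V) (ν : Finset V → ℝ) : Continuous (fun w => lZ A ν w) := by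
  unfold lZ
  fun_prop

lemma lGamma_eq (A : Finset V) (ν : Finset V → ℝ) (e : V) (w : V → ℝ) :
    lGamma A ν e w = lZ (A.erase e) (fun S => ν (insert e S)) w / lZ (A.erase e) ν w := rfl

lemma lZ_update (A : Finset V) (ν : Finset V → ℝ) (e : V) (w : V → ℝ) (s : ℝ) (he : e ∉ A) :
    lZ A ν (Function.update w e s) = lZ A ν w :=
  lZ_congr_w _ _ fun k hk => by
    rw [Function.update_of_ne]
    rintro rfl
    exact he hk

/-- From one coordinate to all coordinates. -/
lemma mono_of_coord (A : Finset V) (f : (V → ℝ) → ℝ)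
    (hcongr : ∀ w w' : V → ℝ, (∀ k ∈ A, w k = w' k) → f w = f w')
    (h1 : ∀ w : V → ℝ, (∀ k ∈ A, 0 < w k) → ∀ e ∈ A, ∀ s, w e ≤ s →
      f w ≤ f (Function.update w e s))
    (a b : V → ℝ) (ha : ∀ k ∈ A, 0 < a k) (hab : ∀ k ∈ A, a k ≤ b k) : f a ≤ f b := by
  have key : ∀ T : Finset V, T ⊆ A → f a ≤ f (T.piecewise b a) := by
    intro T
    induction T using Finset.induction_on with
    | empty => intro _; simp
    | insert e T he ih =>
      intro hT
      have heA : e ∈ A := hT (Finset.mem_insert_self e T)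
      refine (ih fun x hx => hT (Finset.mem_insert_of_mem hx)).trans ?_
      rw [Finset.piecewise_insert]
      refine h1 _ (fun k hk => ?_) e heA _ ?_
      · by_cases hkT : k ∈ T
        · simp only [Finset.piecewise_eq_of_mem _ _ _ hkT]
          exact (ha k hk).trans_le (hab k hk)
        · simp only [Finset.piecewise_eq_of_notMem _ _ _ hkT]
          exact ha k hk
      · simp only [Finset.piecewise_eq_of_notMem _ _ _ he]
        exact hab e heA
  refine (key A subset_rfl).trans_eq (hcongr _ _ fun k hk => ?_)
  simp [hk]

section CM

variable {A : Finset V} {ν : Finset V → ℝ}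

lemma cm_nonneg (h : lCavityMonotone A ν) (S : Finset V) (hS : S ⊆ A) : 0 ≤ ν S :=
  h.1 S (Finset.mem_powerset.2 hS)

lemma cm_rayleigh (h : lCavityMonotone A ν) (w : V → ℝ) (hw : ∀ k ∈ A, 0 < w k)
    {e f : V} (he : e ∈ A) (hf : f ∈ A) (hef : e ≠ f) :
    lZ ((A.erase e).erase f) (fun S => ν (insert e (insert f S))) w *
      lZ ((A.erase e).erase f) ν w ≤
    lZ ((A.erase e).erase f) (fun S => ν (insert e S)) w *
      lZ ((A.erase e).erase f) (fun S => ν (insert f S)) w := by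
  have hf' : f ∈ A.erase e := Finset.mem_erase.2 ⟨hef.symm, hf⟩
  have he' : e ∈ A.erase f := Finset.mem_erase.2 ⟨hef, he⟩
  have hZ : 0 < lZ A ν w := lZ_pos A ν w (cm_nonneg h) h.2.1 fun k hk => (hw k hk).le
  have hR := h.2.2.1 w hw e he f hf hef
  unfold lProb at hR
  rw [lZ_filter_mem2 A ν w he hf hef, lZ_filter_mem A ν w he, lZ_filter_mem A ν w hf,
    lZ_split (A.erase e) (fun S => ν (insert e S)) w hf',
    lZ_split (A.erase f) (fun S => ν (insert f S)) w he'] at hR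
  have h3 : lZ ((A.erase e).erase f) (fun S => ν (insert f (insert e S))) w =
      lZ ((A.erase e).erase f) (fun S => ν (insert e (insert f S))) w :=
    lZ_congr_nu _ _ fun S _ => by rw [Finset.insert_comm]
  rw [Finset.erase_right_comm (a := f) (b := e), h3, div_mul_div_comm,
    div_le_div_iff₀ hZ (mul_pos hZ hZ)] at hR
  have hZ' : lZ A ν w = lZ ((A.erase e).erase f) ν w
      + w f * lZ ((A.erase e).erase f) (fun S => ν (insert f S)) w
      + w e * (lZ ((A.erase e).erase f) (fun S => ν (insert e S)) w
        + w f * lZ ((A.erase e).erase f) (fun S => ν (insert e (insert f S))) w) := by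
    rw [lZ_split A ν w he, lZ_split (A.erase e) ν w hf',
      lZ_split (A.erase e) (fun S => ν (insert e S)) w hf']
  generalize lZ ((A.erase e).erase f) (fun S => ν (insert e (insert f S))) w = b at *
  generalize lZ ((A.erase e).erase f) ν w = c at *
  generalize lZ ((A.erase e).erase f) (fun S => ν (insert e S)) w = a at *
  generalize lZ ((A.erase e).erase f) (fun S => ν (insert f S)) w = d at *
  have hpos : 0 < w e * w f * lZ A ν w := mul_pos (mul_pos (hw e he) (hw f hf)) hZ
  have h4 : (w e * w f * lZ A ν w) * (b * lZ A ν w) ≤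
      (w e * w f * lZ A ν w) * ((a + w f * b) * (d + w e * b)) := by nlinarith
  have h5 := le_of_mul_le_mul_left h4 hpos
  rw [hZ'] at h5
  nlinarith

lemma lGamma_coord (h : lCavityMonotone A ν) {e : V} (he : e ∈ A) (w : V → ℝ)
    (hw : ∀ k ∈ A, 0 < w k) (f : V) (hf : f ∈ A) (s : ℝ) (hs : w f ≤ s) :
    lGamma A ν e (Function.update w f s) ≤ lGamma A ν e w := by
  by_cases hef : e = f
  · subst hef
    rw [lGamma_eq, lGamma_eq, lZ_update _ _ _ _ _ (Finset.notMem_erase e A),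
      lZ_update _ _ _ _ _ (Finset.notMem_erase e A)]
  have hf' : f ∈ A.erase e := Finset.mem_erase.2 ⟨Ne.symm hef, hf⟩
  have hR := cm_rayleigh h w hw he hf hef
  have hn := Finset.notMem_erase f (A.erase e)
  have hsub : (A.erase e).erase f ⊆ A :=
    (Finset.erase_subset _ _).trans (Finset.erase_subset _ _)
  have hc : 0 < lZ ((A.erase e).erase f) ν w :=
    lZ_pos _ ν w (fun S hS => cm_nonneg h S (hS.trans hsub)) h.2.1
      fun k hk => (hw k (hsub hk)).le
  have hd : 0 ≤ lZ ((A.erase e).erase f) (fun S => ν (insert f S)) w :=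
    lZ_nonneg _ _ w (fun S hS => cm_nonneg h _ (Finset.insert_subset hf (hS.trans hsub)))
      fun k hk => (hw k (hsub hk)).le
  have hwf := hw f hf
  rw [lGamma_eq, lGamma_eq, lZ_split (A.erase e) ν w hf',
    lZ_split (A.erase e) (fun S => ν (insert e S)) w hf',
    lZ_split (A.erase e) ν _ hf',
    lZ_split (A.erase e) (fun S => ν (insert e S)) (Function.update w f s) hf',
    lZ_update _ _ _ _ _ hn, lZ_update _ _ _ _ _ hn, lZ_update _ _ _ _ _ hn,
    lZ_update _ _ _ _ _ hn, Function.update_self]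
  generalize lZ ((A.erase e).erase f) (fun S => ν (insert e (insert f S))) w = b at *
  generalize lZ ((A.erase e).erase f) ν w = c at *
  generalize lZ ((A.erase e).erase f) (fun S => ν (insert e S)) w = a at *
  generalize lZ ((A.erase e).erase f) (fun S => ν (insert f S)) w = d at *
  have hs0 : 0 < s := hwf.trans_le hs
  rw [div_le_div_iff₀ (by positivity) (by positivity)]
  nlinarith [mul_nonneg (sub_nonneg.2 hs) (sub_nonneg.2 hR)]

lemma lGamma_congr (A : Finset V) (ν : Finset V → ℝ) (e : V) {w w' : V → ℝ}
    (h : ∀ k ∈ A, w k = w' k) : lGamma A ν e w = lGamma A ν e w' := by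
  rw [lGamma_eq, lGamma_eq, lZ_congr_w _ _ fun k hk => h k (Finset.mem_of_mem_erase hk),
    lZ_congr_w _ ν fun k hk => h k (Finset.mem_of_mem_erase hk)]

lemma den_pos (h : lCavityMonotone A ν) (e : V) (w : V → ℝ)
    (hw : ∀ k ∈ A, 0 ≤ w k) : 0 < lZ (A.erase e) ν w :=
  lZ_pos _ ν w (fun S hS => cm_nonneg h S (hS.trans (Finset.erase_subset _ _))) h.2.1
      fun k hk => hw k (Finset.mem_of_mem_erase hk)

lemma lGamma_continuousAt (h : lCavityMonotone A ν) (e : V) (w : V → ℝ)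
    (hw : ∀ k ∈ A, 0 ≤ w k) : ContinuousAt (fun w => lGamma A ν e w) w := by
  simp only [lGamma_eq]
  exact (lZ_continuous _ _).continuousAt.div (lZ_continuous _ _).continuousAt
    (den_pos h e w hw).ne'

lemma lGamma_anti_pos (h : lCavityMonotone A ν) {e : V} (he : e ∈ A) (a b : V → ℝ)
    (ha : ∀ k ∈ A, 0 < a k) (hab : ∀ k ∈ A, a k ≤ b k) : lGamma A ν e b ≤ lGamma A ν e a := by
  have := mono_of_coord A (fun w => - lGamma A ν e w)
    (fun w w' hww => by simp only [lGamma_congr A ν e hww])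
    (fun w hw f hf s hs => neg_le_neg (lGamma_coord h he w hw f hf s hs)) a b ha hab
  exact neg_le_neg_iff.1 this

lemma lGamma_anti (h : lCavityMonotone A ν) {e : V} (he : e ∈ A) (a b : V → ℝ)
    (ha : ∀ k ∈ A, 0 ≤ a k) (hab : ∀ k ∈ A, a k ≤ b k) : lGamma A ν e b ≤ lGamma A ν e a := by
  have key : ∀ c : V → ℝ, (∀ k ∈ A, 0 ≤ c k) →
      Tendsto (fun ε : ℝ => lGamma A ν e (fun k => c k + ε)) (nhdsWithin 0 (Set.Ioi 0))
        (nhds (lGamma A ν e c)) := by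
    intro c hc
    have h1 : Tendsto (fun ε : ℝ => (fun k => c k + ε)) (nhds 0) (nhds c) := by
      have : Continuous (fun ε : ℝ => (fun k => c k + ε)) := by fun_prop
      have h2 := this.tendsto 0
      simpa using h2
    exact ((lGamma_continuousAt h e c hc).tendsto.comp h1).mono_left nhdsWithin_le_nhds
  refine le_of_tendsto_of_tendsto (key b fun k hk => (ha k hk).trans (hab k hk)) (key a ha) ?_
  filter_upwards [self_mem_nhdsWithin] with ε hε
  have hε' : 0 < ε := hε
  exact lGamma_anti_pos h he _ _ (fun k hk => by have := ha k hk; positivity)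
    (fun k hk => by have := hab k hk; linarith)

lemma lEnergyNum_coord (h : lCavityMonotone A ν) (w : V → ℝ) (hw : ∀ k ∈ A, 0 < w k)
    {e : V} (he : e ∈ A) :
    lZ (A.erase e) (fun S => (S.card : ℝ) * ν S) w * lZ (A.erase e) (fun S => ν (insert e S)) w <
    lZ (A.erase e) (fun S => ((insert e S).card : ℝ) * ν (insert e S)) w * lZ (A.erase e) ν w := by
  have hZ : 0 < lZ A ν w := lZ_pos A ν w (cm_nonneg h) h.2.1 fun k hk => (hw k hk).le
  have hS := h.2.2.2 w hw e he
  unfold lEnergy lProb lEnergyIn at hS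
  rw [lZ_filter_mem A ν w he, lZ_filter_mem A (fun S => (S.card : ℝ) * ν S) w he,
    show ∑ S ∈ A.powerset, (S.card : ℝ) * ν S * ∏ k ∈ S, w k =
      lZ A (fun S => (S.card : ℝ) * ν S) w from rfl,
    lZ_split A (fun S => (S.card : ℝ) * ν S) w he, div_mul_div_comm,
    div_lt_div_iff₀ (mul_pos hZ hZ) hZ] at hS
  have hZ' := lZ_split A ν w he
  have hpos : 0 < w e * lZ A ν w := mul_pos (hw e he) hZ
  generalize lZ (A.erase e) (fun S => (S.card : ℝ) * ν S) w = a at *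
  generalize lZ (A.erase e) (fun S => ν (insert e S)) w = d at *
  generalize lZ (A.erase e) (fun S => ((insert e S).card : ℝ) * ν (insert e S)) w = b at *
  generalize lZ (A.erase e) ν w = c at *
  have h4 : (w e * lZ A ν w) * ((a + w e * b) * d) < (w e * lZ A ν w) * (b * lZ A ν w) := by
    nlinarith
  have h5 := lt_of_mul_lt_mul_left h4 hpos.le
  rw [hZ'] at h5
  nlinarith

lemma lEnergy_eq (A : Finset V) (ν : Finset V → ℝ) (w : V → ℝ) :
    lEnergy A ν w = lZ A (fun S => (S.card : ℝ) * ν S) w / lZ A ν w := rfl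

lemma lEnergy_coord (h : lCavityMonotone A ν) (w : V → ℝ) (hw : ∀ k ∈ A, 0 < w k)
    (e : V) (he : e ∈ A) (s : ℝ) (hs : w e < s) :
    lEnergy A ν w < lEnergy A ν (Function.update w e s) := by
  have hR := lEnergyNum_coord h w hw he
  have hn := Finset.notMem_erase e A
  have hc : 0 < lZ (A.erase e) ν w := den_pos h e w fun k hk => (hw k hk).le
  have hd : 0 ≤ lZ (A.erase e) (fun S => ν (insert e S)) w :=
    lZ_nonneg _ _ w (fun S hS => cm_nonneg h _ (Finset.insert_subset he
      (hS.trans (Finset.erase_subset _ _)))) fun k hk => (hw k (Finset.mem_of_mem_erase hk)).le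
  have hwe := hw e he
  have hs0 : 0 < s := hwe.trans hs
  rw [lEnergy_eq, lEnergy_eq, lZ_split A ν w he, lZ_split A (fun S => (S.card : ℝ) * ν S) w he,
    lZ_split A ν _ he, lZ_split A (fun S => (S.card : ℝ) * ν S) (Function.update w e s) he,
    lZ_update _ _ _ _ _ hn, lZ_update _ _ _ _ _ hn, lZ_update _ _ _ _ _ hn,
    lZ_update _ _ _ _ _ hn, Function.update_self]
  generalize lZ (A.erase e) (fun S => (S.card : ℝ) * ν S) w = a at *
  generalize lZ (A.erase e) (fun S => ν (insert e S)) w = d at *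
  generalize lZ (A.erase e) (fun S => ((insert e S).card : ℝ) * ν (insert e S)) w = b at *
  generalize lZ (A.erase e) ν w = c at *
  rw [div_lt_div_iff₀ (by positivity) (by positivity)]
  nlinarith [mul_pos (sub_pos.2 hs) (sub_pos.2 hR)]

lemma lEnergy_mono (h : lCavityMonotone A ν) (a b : V → ℝ)
    (ha : ∀ k ∈ A, 0 < a k) (hab : ∀ k ∈ A, a k ≤ b k) : lEnergy A ν a ≤ lEnergy A ν b := by
  refine mono_of_coord A (fun w => lEnergy A ν w) (fun w w' hww => ?_)
    (fun w hw e he s hs => ?_) a b ha hab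
  · simp only [lEnergy_eq, lZ_congr_w A _ hww]
  · rcases hs.eq_or_lt with rfl | hs
    · simp
    · exact (lEnergy_coord h w hw e he s hs).le

lemma lEnergy_strict (h : lCavityMonotone A ν) (a b : V → ℝ)
    (ha : ∀ k ∈ A, 0 < a k) (hab : ∀ k ∈ A, a k ≤ b k) {e : V} (he : e ∈ A) (hlt : a e < b e) :
    lEnergy A ν a < lEnergy A ν b := by
  refine (lEnergy_coord h a ha e he _ hlt).trans_le (lEnergy_mono h _ _ (fun k hk => ?_)
    fun k hk => ?_)
  · by_cases hke : k = e
    · subst hke; simpa using (ha k hk).trans hlt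
    · simpa [hke] using ha k hk
  · by_cases hke : k = e
    · subst hke; simp
    · simpa [hke] using hab k hk

lemma single_pos (h : lCavityMonotone A ν) {e : V} (he : e ∈ A) : 0 < ν {e} := by
  have hge : (0:ℝ) < lGamma A ν e (fun _ => 1) := by
    rw [lGamma_eq]
    refine div_pos ?_ (den_pos h e _ (by simp))
    have hd : 0 ≤ lZ (A.erase e) (fun S => ν (insert e S)) (fun _ => 1) :=
      lZ_nonneg _ _ _ (fun S hS => cm_nonneg h _ (Finset.insert_subset he
        (hS.trans (Finset.erase_subset _ _)))) (by simp)
    refine hd.lt_of_ne' fun h0 => ?_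
    have hR := lEnergyNum_coord h (fun _ => 1) (by simp) he
    have hz : ∀ S ∈ (A.erase e).powerset, ν (insert e S) = 0 := by
      intro S hS
      have := (Finset.sum_eq_zero_iff_of_nonneg (fun S hS => by
        rw [Finset.mem_powerset] at hS
        have := cm_nonneg h _ (Finset.insert_subset he (hS.trans (Finset.erase_subset _ _)))
        simpa using this)).1 h0 S hS
      simpa using this
    have hb : lZ (A.erase e) (fun S => ((insert e S).card : ℝ) * ν (insert e S)) (fun _ => 1)
        = 0 := by
      refine (lZ_congr_nu (ν' := fun _ => 0) _ _ fun S hS => ?_).trans (lZ_zero _ _)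
      rw [hz S (Finset.mem_powerset.2 hS), mul_zero]
    rw [hb, h0] at hR
    simp at hR
  have h0 : lGamma A ν e (fun _ => 0) = ν {e} / ν ∅ := by
    have key : ∀ ν' : Finset V → ℝ, lZ (A.erase e) ν' (fun _ => 0) = ν' ∅ := by
      intro ν'
      unfold lZ
      rw [Finset.sum_eq_single ∅]
      · simp
      · intro S _ hS
        obtain ⟨k, hk⟩ := Finset.nonempty_iff_ne_empty.2 hS
        rw [Finset.prod_eq_zero hk rfl, mul_zero]
      · simp
    rw [lGamma_eq, key, key]
    rfl
  have h1 := lGamma_anti h he (fun _ => 0) (fun _ => 1) (by simp) (by simp)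
  rw [h0] at h1
  have h2 := hge.trans_le h1
  have h3 := mul_pos h2 h.2.1
  rwa [div_mul_cancel₀ _ h.2.1.ne'] at h3

lemma lGamma_pos (h : lCavityMonotone A ν) {e : V} (he : e ∈ A) (w : V → ℝ)
    (hw : ∀ k ∈ A, 0 ≤ w k) : 0 < lGamma A ν e w := by
  rw [lGamma_eq]
  refine div_pos (lZ_pos _ _ _ (fun S hS => cm_nonneg h _ (Finset.insert_subset he
        (hS.trans (Finset.erase_subset _ _)))) (single_pos h he)
        fun k hk => hw k (Finset.mem_of_mem_erase hk)) (den_pos h e w hw)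

lemma lEnergy_sum (h : lCavityMonotone A ν) (w : V → ℝ) (hw : ∀ k ∈ A, 0 ≤ w k) :
    lEnergy A ν w = ∑ e ∈ A, (w e * lGamma A ν e w) / (1 + w e * lGamma A ν e w) := by
  have hnum : lZ A (fun S => (S.card : ℝ) * ν S) w =
      ∑ e ∈ A, w e * lZ (A.erase e) (fun S => ν (insert e S)) w := by
    rw [Finset.sum_congr rfl fun e he => (lZ_filter_mem A ν w he).symm]
    simp_rw [Finset.sum_filter]
    rw [Finset.sum_comm]
    unfold lZ
    refine Finset.sum_congr rfl fun S hS => ?_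
    rw [Finset.mem_powerset] at hS
    rw [← Finset.sum_filter, Finset.sum_const, Finset.filter_mem_eq_inter,
      Finset.inter_eq_right.2 hS, nsmul_eq_mul, mul_assoc]
  rw [lEnergy_eq, hnum, Finset.sum_div]
  refine Finset.sum_congr rfl fun e he => ?_
  have hc := den_pos h e w hw
  have hZ : 0 < lZ A ν w := lZ_pos A ν w (cm_nonneg h) h.2.1 hw
  rw [lGamma_eq, lZ_split A ν w he]
  rw [lZ_split A ν w he] at hZ
  field_simp

end CM

end Helpers

section Network

variable {V : Type*} [Fintype V] [DecidableEq V]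

lemma cavStep_eq (G : SimpleGraph V) [DecidableRel G.Adj] (μ : V → Finset V → ℝ) (t : ℝ)
    (x : V → V → ℝ) (i j : V) :
    cavStep G μ t x i j = t * lGamma (G.neighborFinset i) (μ i) j (fun k => x k i) := rfl

lemma cavStep_pos (G : SimpleGraph V) [DecidableRel G.Adj] (μ : V → Finset V → ℝ)
    (hcm : ∀ i : V, lCavityMonotone (G.neighborFinset i) (μ i)) (t : ℝ) (ht : 0 < t)
    (a : V → V → ℝ) (ha : ∀ i j, G.Adj i j → 0 ≤ a i j) (i j : V) (hij : G.Adj i j) :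
    0 < cavStep G μ t a i j := by
  rw [cavStep_eq]
  exact mul_pos ht (lGamma_pos (hcm i) (by simpa using hij) _
    fun k hk => ha k i (by simpa using (G.mem_neighborFinset i k).1 hk |>.symm))

lemma cavStep_anti (G : SimpleGraph V) [DecidableRel G.Adj] (μ : V → Finset V → ℝ)
    (hcm : ∀ i : V, lCavityMonotone (G.neighborFinset i) (μ i)) (t : ℝ) (ht : 0 < t)
    (a b : V → V → ℝ) (ha : ∀ i j, G.Adj i j → 0 ≤ a i j)
    (hab : ∀ i j, G.Adj i j → a i j ≤ b i j) (i j : V) (hij : G.Adj i j) :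
    cavStep G μ t b i j ≤ cavStep G μ t a i j := by
  rw [cavStep_eq, cavStep_eq]
  have hk : ∀ k ∈ G.neighborFinset i, G.Adj k i := fun k hk =>
    ((G.mem_neighborFinset i k).1 hk).symm
  exact mul_le_mul_of_nonneg_left (lGamma_anti (hcm i) (by simpa using hij) _ _
    (fun k h => ha k i (hk k h)) (fun k h => hab k i (hk k h))) ht.le

lemma cavStep_congr (G : SimpleGraph V) [DecidableRel G.Adj] (μ : V → Finset V → ℝ) (t : ℝ)
    (a b : V → V → ℝ) (hab : ∀ i j, G.Adj i j → a i j = b i j) (i j : V) :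
    cavStep G μ t a i j = cavStep G μ t b i j := by
  rw [cavStep_eq, cavStep_eq, lGamma_congr]
  exact fun k hk => hab k i ((G.mem_neighborFinset i k).1 hk).symm

lemma cavStep_tendsto (G : SimpleGraph V) [DecidableRel G.Adj] (μ : V → Finset V → ℝ)
    (hcm : ∀ i : V, lCavityMonotone (G.neighborFinset i) (μ i)) (t : ℝ)
    (u : ℕ → V → V → ℝ) (a : V → V → ℝ) (ha : ∀ i j, G.Adj i j → 0 ≤ a i j)
    (hu : ∀ i j, G.Adj i j → Tendsto (fun k => u k i j) atTop (nhds (a i j)))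
    (i j : V) :
    Tendsto (fun k => cavStep G μ t (u k) i j) atTop (nhds (cavStep G μ t a i j)) := by
  let a' : V → V → ℝ := fun i j => if G.Adj i j then a i j else 0
  let u' : ℕ → V → V → ℝ := fun k i j => if G.Adj i j then u k i j else 0
  have h1 : ∀ k, cavStep G μ t (u k) i j = cavStep G μ t (u' k) i j := fun k =>
    cavStep_congr G μ t _ _ (fun i j h => by simp [u', h]) i j
  have h2 : cavStep G μ t a i j = cavStep G μ t a' i j :=
    cavStep_congr G μ t _ _ (fun i j h => by simp [a', h]) i j
  simp only [h1, h2, cavStep_eq]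
  refine Tendsto.const_mul t ?_
  have hc := lGamma_continuousAt (hcm i) j (fun k => a' k i) (fun k hk => by
    have h := ((G.mem_neighborFinset i k).1 hk).symm
    simpa [a', h] using ha k i h)
  refine hc.tendsto.comp (tendsto_pi_nhds.2 fun k => ?_)
  by_cases h : G.Adj k i
  · simpa [u', a', h] using hu k i h
  · simp [u', a', h]

lemma sandwich (G : SimpleGraph V) [DecidableRel G.Adj] (μ : V → Finset V → ℝ)
    (hcm : ∀ i : V, lCavityMonotone (G.neighborFinset i) (μ i)) (t : ℝ) (ht : 0 < t)
    (y : V → V → ℝ) (hy : ∀ i j, G.Adj i j → 0 ≤ y i j) (k : ℕ) :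
    ∀ m, 2 * k + 1 ≤ m → ∀ i j, G.Adj i j →
      (cavStep G μ t)^[2 * k] (fun _ _ => 0) i j ≤ (cavStep G μ t)^[m] y i j ∧
      (cavStep G μ t)^[m] y i j ≤ (cavStep G μ t)^[2 * k + 1] (fun _ _ => 0) i j := by
  have nn : ∀ z : V → V → ℝ, (∀ i j, G.Adj i j → 0 ≤ z i j) → ∀ m i j, G.Adj i j →
      0 ≤ (cavStep G μ t)^[m] z i j := by
    intro z hz m
    induction m with
    | zero => exact hz
    | succ m ih =>
      intro i j hij
      rw [Function.iterate_succ_apply']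
      exact (cavStep_pos G μ hcm t ht _ ih i j hij).le
  have nn0 := nn (fun _ _ => 0) (fun _ _ _ => le_rfl)
  have nny := nn y hy
  induction k with
  | zero =>
    intro m hm i j hij
    obtain ⟨m, rfl⟩ : ∃ m', m = m' + 1 := ⟨m - 1, by omega⟩
    refine ⟨nny _ i j hij, ?_⟩
    rw [Function.iterate_succ_apply']
    exact cavStep_anti G μ hcm t ht _ _ (fun _ _ _ => le_rfl) (nny m) i j hij
  | succ k ih =>
    have low : ∀ m, 2 * k + 2 ≤ m → ∀ i j, G.Adj i j →
        (cavStep G μ t)^[2 * k + 1 + 1] (fun _ _ => 0) i j ≤ (cavStep G μ t)^[m] y i j := by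
      intro m hm i j hij
      obtain ⟨m, rfl⟩ : ∃ m', m = m' + 1 := ⟨m - 1, by omega⟩
      rw [Function.iterate_succ_apply' _ (2 * k + 1), Function.iterate_succ_apply' _ m]
      exact cavStep_anti G μ hcm t ht _ _ (nny m)
        (fun i j hij => (ih m (by omega) i j hij).2) i j hij
    intro m hm i j hij
    refine ⟨low m (by omega) i j hij, ?_⟩
    obtain ⟨m, rfl⟩ : ∃ m', m = m' + 1 := ⟨m - 1, by omega⟩
    rw [show 2 * (k + 1) + 1 = (2 * k + 1 + 1) + 1 by ring,
      Function.iterate_succ_apply' _ m, Function.iterate_succ_apply' _ (2 * k + 1 + 1)]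
    exact cavStep_anti G μ hcm t ht _ _ (nn0 _)
      (fun i j hij => low m (by omega) i j hij) i j hij

/-- Two-cycles of the cavity operator are trivial. -/
lemma two_cycle (G : SimpleGraph V) [DecidableRel G.Adj] (μ : V → Finset V → ℝ)
    (hcm : ∀ i : V, lCavityMonotone (G.neighborFinset i) (μ i)) (t : ℝ) (ht : 0 < t)
    (a b : V → V → ℝ) (ha : ∀ i j, G.Adj i j → 0 < a i j)
    (hab : ∀ i j, G.Adj i j → a i j ≤ b i j)
    (h1 : ∀ i j, G.Adj i j → cavStep G μ t a i j = b i j)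
    (h2 : ∀ i j, G.Adj i j → cavStep G μ t b i j = a i j) (i j : V) (hij : G.Adj i j) :
    a i j = b i j := by
  have hadj : ∀ i, ∀ k ∈ G.neighborFinset i, G.Adj k i := fun i k hk =>
    ((G.mem_neighborFinset i k).1 hk).symm
  have hb : ∀ i j, G.Adj i j → 0 < b i j := fun i j h => (ha i j h).trans_le (hab i j h)
  -- energy as a sum over oriented edges
  have key : ∀ c d : V → V → ℝ, (∀ i j, G.Adj i j → 0 < c i j) →
      (∀ i j, G.Adj i j → cavStep G μ t c i j = d i j) →
      ∑ i, lEnergy (G.neighborFinset i) (μ i) (fun k => c k i) =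
        ∑ i, ∑ j, if G.Adj i j then
          (c j i * d i j / t) / (1 + c j i * d i j / t) else 0 := by
    intro c d hc hcd
    refine Finset.sum_congr rfl fun i _ => ?_
    rw [lEnergy_sum (hcm i) _ fun k hk => (hc k i (hadj i k hk)).le, ← Finset.sum_filter,
      ← SimpleGraph.neighborFinset_eq_filter]
    refine Finset.sum_congr rfl fun j hj => ?_
    have hd := hcd i j (hadj i j hj).symm
    rw [cavStep_eq] at hd
    rw [← hd]
    have : ∀ g : ℝ, c j i * (t * g) / t = c j i * g := fun g => by field_simp
    rw [this]
  have hsum : ∑ i, lEnergy (G.neighborFinset i) (μ i) (fun k => a k i) =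
      ∑ i, lEnergy (G.neighborFinset i) (μ i) (fun k => b k i) := by
    rw [key a b ha h1, key b a hb h2, Finset.sum_comm]
    refine Finset.sum_congr rfl fun i _ => Finset.sum_congr rfl fun j _ => ?_
    simp only [G.adj_comm j i, mul_comm (a i j)]
  by_contra hne
  have hlt : a i j < b i j := (hab i j hij).lt_of_ne hne
  have : ∑ i, lEnergy (G.neighborFinset i) (μ i) (fun k => a k i) <
      ∑ i, lEnergy (G.neighborFinset i) (μ i) (fun k => b k i) := by
    refine Finset.sum_lt_sum (fun l _ => ?_) ⟨j, Finset.mem_univ j, ?_⟩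
    · exact lEnergy_mono (hcm l) _ _ (fun k hk => ha k l (hadj l k hk))
        (fun k hk => hab k l (hadj l k hk))
    · exact lEnergy_strict (hcm j) _ _ (fun k hk => ha k j (hadj j k hk))
        (fun k hk => hab k j (hadj j k hk)) (e := i) (by simpa using hij.symm) hlt
  exact this.ne hsum

end Network

/-- on a finite cavity-monotone network, the cavity equation at any
activity `t > 0` has a unique nonnegative solution, which is globally attractive. -/
theorem stmt10 {V : Type*} [Fintype V] [DecidableEq V] (G : SimpleGraph V)
    [DecidableRel G.Adj] (μ : V → Finset V → ℝ)
    (hcm : ∀ i : V, lCavityMonotone (G.neighborFinset i) (μ i))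
    (t : ℝ) (ht : 0 < t) :
    ∃ x : V → V → ℝ,
      (∀ i j, 0 ≤ x i j) ∧
      (∀ i j, G.Adj i j → x i j = t * cavOp G μ x i j) ∧
      (∀ y : V → V → ℝ, (∀ i j, 0 ≤ y i j) →
        (∀ i j, G.Adj i j → y i j = t * cavOp G μ y i j) →
        ∀ i j, G.Adj i j → y i j = x i j) ∧
      (∀ x0 : V → V → ℝ, (∀ i j, 0 ≤ x0 i j) → ∀ i j, G.Adj i j →
        Tendsto (fun k : ℕ => (cavStep G μ t)^[k] x0 i j) atTop (nhds (x i j))) := by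
  set F := cavStep G μ t with hF
  set X : ℕ → V → V → ℝ := fun k => F^[k] (fun _ _ => 0) with hX
  have hXs : ∀ k i j, X (k + 1) i j = F (X k) i j := fun k i j => by
    simp only [hX, Function.iterate_succ_apply']
  have sw : ∀ k m, 2 * k + 1 ≤ m → ∀ i j, G.Adj i j →
      X (2 * k) i j ≤ X m i j ∧ X m i j ≤ X (2 * k + 1) i j := fun k =>
    sandwich G μ hcm t ht (fun _ _ => 0) (fun _ _ _ => le_rfl) k
  have hX0 : ∀ k i j, G.Adj i j → 0 ≤ X k i j := by
    intro k i j hij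
    rcases Nat.eq_zero_or_pos k with rfl | hk
    · simp [hX]
    · exact (sw 0 k (by omega) i j hij).1
  have hup : ∀ k i j, G.Adj i j → X k i j ≤ X 1 i j := by
    intro k i j hij
    rcases Nat.eq_zero_or_pos k with rfl | hk
    · exact (sw 0 1 (by omega) i j hij).1
    · exact (sw 0 k (by omega) i j hij).2
  have ex1 : ∀ i j, ∃ l : ℝ, G.Adj i j → Tendsto (fun k => X (2 * k) i j) atTop (nhds l) := by
    intro i j
    by_cases hij : G.Adj i j
    · refine ⟨_, fun _ => tendsto_atTop_ciSup (monotone_nat_of_le_succ fun k => ?_)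
        ⟨X 1 i j, ?_⟩⟩
      · exact (sw k (2 * (k + 1)) (by omega) i j hij).1
      · rintro _ ⟨k, rfl⟩
        exact hup _ i j hij
    · exact ⟨0, fun h => absurd h hij⟩
  have ex2 : ∀ i j, ∃ l : ℝ, G.Adj i j →
      Tendsto (fun k => X (2 * k + 1) i j) atTop (nhds l) := by
    intro i j
    by_cases hij : G.Adj i j
    · refine ⟨_, fun _ => tendsto_atTop_ciInf (antitone_nat_of_succ_le fun k => ?_)
        ⟨0, ?_⟩⟩
      · exact (sw k (2 * (k + 1) + 1) (by omega) i j hij).2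
      · rintro _ ⟨k, rfl⟩
        exact hX0 _ i j hij
    · exact ⟨0, fun h => absurd h hij⟩
  choose a ha using ex1
  choose b hb using ex2
  have ha0 : ∀ i j, G.Adj i j → 0 ≤ a i j := fun i j hij =>
    ge_of_tendsto' (ha i j hij) fun k => hX0 _ i j hij
  have hb0 : ∀ i j, G.Adj i j → 0 ≤ b i j := fun i j hij =>
    ge_of_tendsto' (hb i j hij) fun k => hX0 _ i j hij
  have hab : ∀ i j, G.Adj i j → a i j ≤ b i j := fun i j hij =>
    le_of_tendsto_of_tendsto' (ha i j hij) (hb i j hij)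
      fun k => (sw k (2 * k + 1) le_rfl i j hij).1
  have h1 : ∀ i j, G.Adj i j → F a i j = b i j := by
    intro i j hij
    have h := cavStep_tendsto G μ hcm t (fun k => X (2 * k)) a ha0 ha i j
    refine tendsto_nhds_unique h ((hb i j hij).congr fun k => ?_)
    exact hXs _ i j
  have h2 : ∀ i j, G.Adj i j → F b i j = a i j := by
    intro i j hij
    have h := cavStep_tendsto G μ hcm t (fun k => X (2 * k + 1)) b hb0 hb i j
    refine tendsto_nhds_unique h (((ha i j hij).comp (tendsto_add_atTop_nat 1)).congr
      fun k => ?_)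
    exact hXs (2 * k + 1) i j
  have hapos : ∀ i j, G.Adj i j → 0 < a i j := fun i j hij => by
    rw [← h2 i j hij]
    exact cavStep_pos G μ hcm t ht b hb0 i j hij
  have heq := two_cycle G μ hcm t ht a b hapos hab h1 h2
  have hconv : ∀ x0 : V → V → ℝ, (∀ i j, 0 ≤ x0 i j) → ∀ i j, G.Adj i j →
      Tendsto (fun k : ℕ => F^[k] x0 i j) atTop (nhds (a i j)) := by
    intro x0 hx0 i j hij
    have sx := sandwich G μ hcm t ht x0 (fun i j _ => hx0 i j)
    refine tendsto_order.2 ⟨fun c hc => ?_, fun c hc => ?_⟩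
    · obtain ⟨k, hk⟩ := ((tendsto_order.1 (ha i j hij)).1 c hc).exists
      filter_upwards [eventually_ge_atTop (2 * k + 1)] with m hm
      exact hk.trans_le (sx k m hm i j hij).1
    · rw [heq i j hij] at hc
      obtain ⟨k, hk⟩ := ((tendsto_order.1 (hb i j hij)).2 c hc).exists
      filter_upwards [eventually_ge_atTop (2 * k + 1)] with m hm
      exact (sx k m hm i j hij).2.trans_lt hk
  let x : V → V → ℝ := fun i j => if G.Adj i j then a i j else 0
  have hxa : ∀ i j, G.Adj i j → x i j = a i j := fun i j h => by simp [x, h]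
  refine ⟨x, ?_, ?_, ?_, ?_⟩
  · intro i j
    by_cases h : G.Adj i j
    · rw [hxa i j h]; exact ha0 i j h
    · simp [x, h]
  · intro i j hij
    change x i j = F x i j
    rw [hF, cavStep_congr G μ t x a hxa i j, hxa i j hij, heq i j hij]
    exact (h1 i j hij).symm
  · intro y hy hfix i j hij
    have hk : ∀ k i j, G.Adj i j → F^[k] y i j = y i j := by
      intro k
      induction k with
      | zero => intro i j _; rfl
      | succ k ih =>
        intro i j hij
        rw [Function.iterate_succ_apply', hF, cavStep_congr G μ t _ y ih i j]
        exact (hfix i j hij).symm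
    rw [hxa i j hij]
    refine tendsto_nhds_unique ?_ (hconv y hy i j hij)
    simp only [hk _ i j hij]
    exact tendsto_const_nhds
  · intro x0 hx0 i j hij
    rw [hxa i j hij]
    exact hconv x0 hx0 i j hij
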